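/- arXiv:2108.13506 — 4 statements merged into one kernel-verified Lean document; each statement's English description precedes it below -/
import Mathlib

section
/- Fix an integer n ≥ 2, x₀ > 0, and κ > 1 (κ = 1 - 2μ/σ² with μ < 0 for exponential Brownian motion). Let λ(·) = (1 - n·(·) + (n-1)·(·)^{n/(n-1)})/n, and for c ∈ [0,1) let H_c be the equilibrium cdf H_c(x) = (c + λ(c)·(x/x₀)^κ)^{1/(n-1)} on [0, x̄(c)], x̄(c) = ((1-c)/λ(c))^{1/κ}·x₀, H_c = 1 above x̄(c). Define M(c) = ∫₀^∞ (1 - H_c(x)ⁿ) dx. Then there exists c ∈ (0,1) with M(c) > M(0): some strictly positive submission fee yields a strictly higher expected winner's performance than no fee. -/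
open MeasureTheory

/-- The slope coefficient `λ(c) = (1 - n·c + (n-1)·c^{n/(n-1)})/n` of the equilibrium
winning probability in the `n`-player risk-taking contest with submission fee `c`. -/
noncomputable def lamFee (n : ℕ) (c : ℝ) : ℝ :=
  (1 - n * c + ((n : ℝ) - 1) * c ^ ((n : ℝ) / ((n : ℝ) - 1))) / n

/-- Upper bound of the support of the equilibrium distribution for exponential Brownian
motion (scale function `s(x) = x^κ/κ`): `x̄(c) = ((1-c)/λ(c))^{1/κ}·x₀`. -/
noncomputable def expXbar (n : ℕ) (x₀ κ c : ℝ) : ℝ :=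
  ((1 - c) / lamFee n c) ^ (1 / κ) * x₀

/-- Equilibrium cdf for exponential Brownian motion:
`H_c(x) = (c + λ(c)·(x/x₀)^κ)^{1/(n-1)}` on `[0, x̄(c)]`, `1` above, `0` below `0`. -/
noncomputable def expF (n : ℕ) (x₀ κ c x : ℝ) : ℝ :=
  if x < 0 then 0
  else if x ≤ expXbar n x₀ κ c then
    (c + lamFee n c * (x / x₀) ^ κ) ^ ((1 : ℝ) / ((n : ℝ) - 1))
  else 1

/-- Expected maximum of `n` i.i.d. draws from the equilibrium distribution:
`M(c) = ∫₀^∞ (1 - H_c(x)ⁿ) dx`. -/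
noncomputable def expExpMax (n : ℕ) (x₀ κ c : ℝ) : ℝ :=
  ∫ x in Set.Ioi (0 : ℝ), (1 - (expF n x₀ κ c x) ^ n)

/-- A function with positive derivative at a point is larger immediately to its right. -/
theorem HasDerivAt.eventually_lt_nhdsGT {f : ℝ → ℝ} {f' a : ℝ} (hf : HasDerivAt f f' a)
    (hf' : 0 < f') : ∀ᶠ x in nhdsWithin a (Set.Ioi a), f a < f x := by
  have hs := (hasDerivAt_iff_tendsto_slope.mp hf).eventually (lt_mem_nhds hf')
  have hs' := hs.filter_mono (nhdsWithin_mono a (fun x (hx : a < x) => hx.ne'))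
  filter_upwards [hs', self_mem_nhdsWithin] with x hx (hax : a < x)
  rw [slope_def_field, div_pos_iff_of_pos_right (sub_pos.mpr hax)] at hx
  linarith

/-- The tangent line of `t ↦ t ^ (1 + q)` at `w` lies below its graph. -/
theorem rpow_one_add_tangent_le {q v w : ℝ} (hq : 0 ≤ q) (hv : 0 ≤ v) (hw : 0 < w) :
    w ^ (1 + q) + (1 + q) * (v - w) * w ^ q ≤ v ^ (1 + q) := by
  have hb := one_add_mul_self_le_rpow_one_add (s := v / w - 1)
    (by linarith [div_nonneg hv hw.le]) (p := 1 + q) (by linarith)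
  rw [add_sub_cancel, Real.div_rpow hv hw.le, le_div_iff₀ (by positivity)] at hb
  refine le_trans (le_of_eq ?_) hb
  rw [Real.rpow_add hw, Real.rpow_one]
  field_simp

/-- First-order upper bound for `t ^ (1 + q)` along the segment from `v` to `1`. -/
theorem rpow_one_add_mix_le {q c v : ℝ} (hq : 0 ≤ q) (hq1 : q ≤ 1) (hc : 0 < c) (hc1 : c < 1)
    (hv : 0 ≤ v) (hv1 : v ≤ 1) :
    (c + (1 - c) * v) ^ (1 + q) ≤ v ^ (1 + q) + (1 + q) * c * ((1 - v) * v ^ q + c ^ q) := by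
  have hw : 0 < c + (1 - c) * v := by nlinarith
  have ht := rpow_one_add_tangent_le hq hv hw
  have hs : (c + (1 - c) * v) ^ q ≤ c ^ q + v ^ q :=
    (Real.rpow_le_rpow hw.le (by nlinarith) hq).trans
      (Real.rpow_add_le_add_rpow hc.le hv hq hq1)
  have hk : 0 ≤ (1 + q) * c * (1 - v) := by
    have : 0 ≤ 1 - v := by linarith
    positivity
  have hm := mul_le_mul_of_nonneg_left hs hk
  have hr : 0 ≤ (1 + q) * c * (v * c ^ q) := by positivity
  have he : (v - (c + (1 - c) * v)) = -(c * (1 - v)) := by ring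
  rw [he] at ht
  nlinarith

/-- Lower bound, to first order in `c`, for the normalized expected maximum. -/
theorem le_integral_one_sub_mix_rpow {q κ c : ℝ} (hq : 0 ≤ q) (hq1 : q ≤ 1) (hκ : 0 < κ)
    (hc : 0 < c) (hc1 : c < 1) :
    1 - 1 / (κ * (1 + q) + 1)
        - (1 + q) * (c * (1 / (κ * q + 1) - 1 / (κ * (1 + q) + 1)) + c ^ (1 + q)) ≤
      ∫ u in (0 : ℝ)..1, (1 - (c + (1 - c) * u ^ κ) ^ (1 + q)) := by
  have hi : ∀ r : ℝ, 0 ≤ r →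
      IntervalIntegrable (fun u : ℝ => u ^ r) volume 0 1 := fun r hr =>
    (Real.continuous_rpow_const hr).intervalIntegrable _ _
  have hκq : 0 ≤ κ * q := by positivity
  have hκp : 0 ≤ κ * (1 + q) := by positivity
  have hI : ∀ r : ℝ, 0 ≤ r → ∫ u in (0 : ℝ)..1, u ^ r = 1 / (r + 1) := by
    intro r hr
    rw [integral_rpow (Or.inl (by linarith)), Real.one_rpow,
      Real.zero_rpow (by linarith), sub_zero]
  have hcont : Continuous fun u : ℝ => 1 - u ^ (κ * (1 + q))
      - (1 + q) * (c * (u ^ (κ * q) - u ^ (κ * (1 + q))) + c ^ (1 + q)) := by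
    have h1 := Real.continuous_rpow_const hκq
    have h2 := Real.continuous_rpow_const hκp
    fun_prop
  have hcont' : Continuous fun u : ℝ => 1 - (c + (1 - c) * u ^ κ) ^ (1 + q) := by
    have h1 := Real.continuous_rpow_const hκ.le
    have h2 := Real.continuous_rpow_const (show (0 : ℝ) ≤ 1 + q by linarith)
    exact continuous_const.sub
      (h2.comp (continuous_const.add (continuous_const.mul h1)))
  calc _ = ∫ u in (0 : ℝ)..1, (1 - u ^ (κ * (1 + q))
      - (1 + q) * (c * (u ^ (κ * q) - u ^ (κ * (1 + q))) + c ^ (1 + q))) := by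
        have h1 := hi _ hκq
        have h2 := hi _ hκp
        rw [intervalIntegral.integral_sub (intervalIntegrable_const.sub h2)
            ((((h1.sub h2).const_mul c).add intervalIntegrable_const).const_mul (1 + q)),
          intervalIntegral.integral_sub intervalIntegrable_const h2,
          intervalIntegral.integral_const_mul,
          intervalIntegral.integral_add ((h1.sub h2).const_mul c) intervalIntegrable_const,
          intervalIntegral.integral_const_mul, intervalIntegral.integral_sub h1 h2,
          hI _ hκq, hI _ hκp]
        simp
    _ ≤ _ := by
        refine intervalIntegral.integral_mono_on zero_le_one (hcont.intervalIntegrable _ _)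
          (hcont'.intervalIntegrable _ _) fun u hu => ?_
        have hv : 0 ≤ u ^ κ := Real.rpow_nonneg hu.1 _
        have hm := rpow_one_add_mix_le hq hq1 hc hc1 hv (Real.rpow_le_one hu.1 hu.2 hκ.le)
        have hvp : u ^ (κ * (1 + q)) = u ^ κ * (u ^ κ) ^ q := by
          rw [Real.rpow_mul hu.1, Real.rpow_add' hv (by linarith), Real.rpow_one]
        rw [← Real.rpow_mul hu.1, hvp] at hm
        rw [hvp, Real.rpow_mul hu.1 κ q, Real.rpow_add hc, Real.rpow_one]
        linarith

/-- Rescaling the support to `[0, 1]` in the expected maximum. -/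
theorem expExpMax_eq_mul_integral {n : ℕ} (hn : 2 ≤ n) {x₀ κ c : ℝ} (hx₀ : 0 < x₀)
    (hκ : 0 < κ) (hc : 0 ≤ c) (hc1 : c < 1) (hlam : 0 < lamFee n c) :
    expExpMax n x₀ κ c = expXbar n x₀ κ c *
      ∫ u in (0 : ℝ)..1, (1 - (c + (1 - c) * u ^ κ) ^ (1 + 1 / ((n : ℝ) - 1))) := by
  have hn1 : (0 : ℝ) < (n : ℝ) - 1 := by
    have : (2 : ℝ) ≤ n := by exact_mod_cast hn
    linarith
  have hr : 0 < (1 - c) / lamFee n c := div_pos (by linarith) hlam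
  have hX : 0 < expXbar n x₀ κ c := mul_pos (Real.rpow_pos_of_pos hr _) hx₀
  have hp : (1 : ℝ) / ((n : ℝ) - 1) * n = 1 + 1 / ((n : ℝ) - 1) := by
    field_simp
    ring
  have hsub : expExpMax n x₀ κ c = ∫ x in Set.Ioc (0 : ℝ) (expXbar n x₀ κ c),
      (1 - (c + lamFee n c * (x / x₀) ^ κ) ^ (1 + 1 / ((n : ℝ) - 1))) := by
    have h := setIntegral_eq_of_subset_of_forall_sdiff_eq_zero (μ := volume)
      (f := fun x => 1 - (expF n x₀ κ c x) ^ n) measurableSet_Ioi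
      (show Set.Ioc 0 (expXbar n x₀ κ c) ⊆ Set.Ioi 0 from Set.Ioc_subset_Ioi_self) (by
        rintro x ⟨hx0, hx⟩
        have hx0 : 0 < x := hx0
        have hx' : ¬ x ≤ expXbar n x₀ κ c := fun h => hx ⟨hx0, h⟩
        simp [expF, hx0.not_gt, hx'])
    rw [expExpMax, h]
    refine setIntegral_congr_fun measurableSet_Ioc fun x hx => ?_
    have hb : 0 ≤ c + lamFee n c * (x / x₀) ^ κ :=
      add_nonneg hc (mul_nonneg hlam.le (Real.rpow_nonneg (div_nonneg hx.1.le hx₀.le) _))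
    simp only [expF, hx.1.not_gt, hx.2, if_true, if_false]
    rw [← Real.rpow_natCast, ← Real.rpow_mul hb, hp]
  rw [hsub, ← intervalIntegral.integral_of_le hX.le]
  have hscale := intervalIntegral.mul_integral_comp_mul_left (a := 0) (b := 1)
    (f := fun x => 1 - (c + lamFee n c * (x / x₀) ^ κ) ^ (1 + 1 / ((n : ℝ) - 1)))
    (expXbar n x₀ κ c)
  rw [mul_zero, mul_one] at hscale
  rw [← hscale]
  congr 1
  refine intervalIntegral.integral_congr fun u hu => ?_
  rw [Set.uIcc_of_le zero_le_one] at hu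
  have hu' : expXbar n x₀ κ c * u / x₀ = ((1 - c) / lamFee n c) ^ (1 / κ) * u := by
    rw [expXbar]
    field_simp
  have hmul : lamFee n c * (expXbar n x₀ κ c * u / x₀) ^ κ = (1 - c) * u ^ κ := by
    rw [hu', Real.mul_rpow (Real.rpow_nonneg hr.le _) hu.1, ← Real.rpow_mul hr.le,
      one_div_mul_cancel hκ.ne', Real.rpow_one]
    field_simp
  simp only [hmul]

theorem lamFee_zero {n : ℕ} (hn : 2 ≤ n) : lamFee n 0 = 1 / n := by
  have : (2 : ℝ) ≤ n := by exact_mod_cast hn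
  rw [lamFee, Real.zero_rpow (div_pos (by linarith) (by linarith)).ne']
  simp

theorem hasDerivAt_lamFee_zero {n : ℕ} (hn : 2 ≤ n) : HasDerivAt (lamFee n) (-1) 0 := by
  have hn2 : (2 : ℝ) ≤ n := by exact_mod_cast hn
  have hp : 1 < (n : ℝ) / ((n : ℝ) - 1) := by
    rw [one_lt_div (by linarith)]
    linarith
  have h := (((((hasDerivAt_id (0 : ℝ)).const_mul (n : ℝ)).const_sub 1).add
    ((Real.hasDerivAt_rpow_const (x := 0) (Or.inr hp.le)).const_mul
      ((n : ℝ) - 1))).div_const (n : ℝ))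
  refine h.congr_deriv ?_
  rw [Real.zero_rpow (by linarith)]
  field_simp
  simp

theorem hasDerivAt_expXbar_zero {n : ℕ} (hn : 2 ≤ n) (x₀ κ : ℝ) :
    HasDerivAt (expXbar n x₀ κ) (((n : ℝ) - 1) / κ * expXbar n x₀ κ 0) 0 := by
  have hn0 : (0 : ℝ) < n := by exact_mod_cast (by omega : 0 < n)
  have hl : lamFee n 0 ≠ 0 := by
    rw [lamFee_zero hn]
    positivity
  have hr : (1 - 0) / lamFee n 0 = (n : ℝ) := by
    rw [lamFee_zero hn]
    simp
  have h := ((((hasDerivAt_id (0 : ℝ)).const_sub 1).div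
    (hasDerivAt_lamFee_zero hn) hl).rpow_const (p := 1 / κ)
      (Or.inl (by simp [lamFee_zero hn, hn0.ne']))).mul_const x₀
  refine h.congr_deriv ?_
  simp only [Pi.div_apply, id_eq, expXbar]
  rw [hr, lamFee_zero hn, Real.rpow_sub hn0, Real.rpow_one]
  field_simp
  ring

/-- For exponential Brownian motion with `κ > 1` (i.e. negative drift `μ < 0`), some
strictly positive submission fee yields a strictly higher expected winner's performance
than no fee. -/
theorem expF_positive_fee_beats_zero (n : ℕ) (hn : 2 ≤ n) (x₀ κ : ℝ)
    (hx₀ : 0 < x₀) (hκ : 1 < κ) :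
    ∃ c ∈ Set.Ioo (0 : ℝ) 1, expExpMax n x₀ κ 0 < expExpMax n x₀ κ c := by
  have hn2 : (2 : ℝ) ≤ n := by exact_mod_cast hn
  have hκ0 : 0 < κ := by linarith
  obtain ⟨q, hq⟩ : ∃ q : ℝ, q = 1 / ((n : ℝ) - 1) := ⟨_, rfl⟩
  have hq0 : 0 < q := by
    rw [hq]
    exact one_div_pos.mpr (by linarith)
  have hq1 : q ≤ 1 := by
    rw [hq, div_le_one (by linarith)]
    linarith
  have hnq : (n : ℝ) - 1 = 1 / q := by rw [hq, one_div_one_div]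
  have hl0 : 0 < lamFee n 0 := by
    rw [lamFee_zero hn]
    positivity
  have hX0 : 0 < expXbar n x₀ κ 0 :=
    mul_pos (Real.rpow_pos_of_pos (div_pos (by norm_num) hl0) _) hx₀
  have hM0 : expExpMax n x₀ κ 0 = expXbar n x₀ κ 0 * (1 - 1 / (κ * (1 + q) + 1)) := by
    rw [expExpMax_eq_mul_integral hn hx₀ hκ0 le_rfl zero_lt_one hl0, ← hq]
    congr 1
    have hκp : 0 ≤ κ * (1 + q) := by positivity
    have hcongr : ∫ u in (0 : ℝ)..1, (1 - (0 + (1 - 0) * u ^ κ) ^ (1 + q)) =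
        ∫ u in (0 : ℝ)..1, (1 - u ^ (κ * (1 + q))) := by
      refine intervalIntegral.integral_congr fun u hu => ?_
      rw [Set.uIcc_of_le zero_le_one] at hu
      simp only [zero_add, sub_zero, one_mul, Real.rpow_mul hu.1]
    rw [hcongr, intervalIntegral.integral_sub intervalIntegrable_const
      ((Real.continuous_rpow_const hκp).intervalIntegrable _ _),
      integral_rpow (Or.inl (by linarith)), Real.one_rpow, Real.zero_rpow (by linarith)]
    simp
  set A := 1 / (κ * q + 1) - 1 / (κ * (1 + q) + 1) with hA
  set G := 1 - 1 / (κ * (1 + q) + 1) with hG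
  have hΦ := (hasDerivAt_expXbar_zero hn x₀ κ).mul
    (((((hasDerivAt_id (0 : ℝ)).mul_const A).add
      (Real.hasDerivAt_rpow_const (x := 0) (p := 1 + q) (Or.inr (by linarith)))).const_mul
        (1 + q)).const_sub G)
  have hpos := hΦ.eventually_lt_nhdsGT (by
    simp only [add_sub_cancel_left, Real.zero_rpow hq0.ne', Real.zero_rpow
      (show 1 + q ≠ 0 by positivity), Pi.add_apply, id_eq, hnq, zero_mul, add_zero, mul_zero,
      sub_zero, one_mul]
    have hid : 1 / q / κ * expXbar n x₀ κ 0 * G + expXbar n x₀ κ 0 * -((1 + q) * A) =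
        expXbar n x₀ κ 0 * ((1 + q) / (q * (κ * q + 1) * (κ * (1 + q) + 1))) := by
      rw [hA, hG]
      field_simp
      ring
    rw [hid]
    positivity)
  have hlam : ∀ᶠ c in nhdsWithin (0 : ℝ) (Set.Ioi 0), 0 < lamFee n c :=
    ((hasDerivAt_lamFee_zero hn).continuousAt.eventually (lt_mem_nhds hl0)).filter_mono
      nhdsWithin_le_nhds
  obtain ⟨c, hlt, hlc, hc⟩ :=
    (hpos.and (hlam.and (Ioo_mem_nhdsGT (zero_lt_one (α := ℝ))))).exists
  refine ⟨c, hc, ?_⟩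
  have hXc : 0 < expXbar n x₀ κ c :=
    mul_pos (Real.rpow_pos_of_pos (div_pos (by linarith [hc.2]) hlc) _) hx₀
  rw [hM0, expExpMax_eq_mul_integral hn hx₀ hκ0 hc.1.le hc.2 hlc, ← hq]
  refine lt_of_lt_of_le ?_ (mul_le_mul_of_nonneg_left
    (le_integral_one_sub_mix_rpow hq0.le hq1 hκ0 hc.1 hc.2) hXc.le)
  simpa [Real.zero_rpow (show 1 + q ≠ 0 by positivity), hA, hG] using hlt
end

section
/- For every real β > 0 and every integer n ≥ 2, ∫₀¹ y^{n-1}·(n·y^{n-1} - 1)/(1 + n·β·y^{n-1}) dy > 0. -/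
theorem integral_natCast_mul_pow_sub_one (n : ℕ) (hn : n ≠ 0) :
    ∫ y in (0 : ℝ)..1, ((n : ℝ) * y ^ (n - 1) - 1) = 0 := by
  obtain ⟨m, rfl⟩ := Nat.exists_eq_succ_of_ne_zero hn
  have hm : (m : ℝ) + 1 ≠ 0 := by positivity
  rw [intervalIntegral.integral_sub (Continuous.intervalIntegrable (by fun_prop) _ _)
    (Continuous.intervalIntegrable (by fun_prop) _ _), intervalIntegral.integral_const_mul]
  simp [integral_pow, hm]

/-- The integral inequality from the proof of Theorem 2 of the paper (Brownian motion
with negative drift): `∫₀¹ y^{n-1}·(n·y^{n-1} - 1)/(1 + n·β·y^{n-1}) dy > 0` for every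
`β > 0` and integer `n ≥ 2`. -/
theorem integral_inequality_BM (β : ℝ) (hβ : 0 < β) (n : ℕ) (hn : 2 ≤ n) :
    0 < ∫ y in (0 : ℝ)..1, y ^ (n - 1) * (n * y ^ (n - 1) - 1) / (1 + n * β * y ^ (n - 1)) := by
  have hn0 : (0 : ℝ) < n := by exact_mod_cast (by lia : 0 < n)
  have hden : ∀ y ∈ Set.Icc (0 : ℝ) 1, 0 < 1 + n * β * y ^ (n - 1) := by
    rintro y ⟨hy, -⟩
    positivity
  have hsplit : ∀ y ∈ Set.Icc (0 : ℝ) 1,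
      y ^ (n - 1) * (n * y ^ (n - 1) - 1) / (1 + n * β * y ^ (n - 1)) =
        (n * (1 + β))⁻¹ * (n * y ^ (n - 1) - 1) +
          (n * (1 + β))⁻¹ * ((n * y ^ (n - 1) - 1) ^ 2 / (1 + n * β * y ^ (n - 1))) := by
    intro y hy
    have := (hden y hy).ne'
    generalize hd : 1 + n * β * y ^ (n - 1) = d at this ⊢
    field_simp
    rw [← hd]
    ring
  calc
    0 = ∫ y in (0 : ℝ)..1, (n * (1 + β))⁻¹ * (n * y ^ (n - 1) - 1) := by
      rw [intervalIntegral.integral_const_mul, integral_natCast_mul_pow_sub_one n (by lia),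
        mul_zero]
    _ < _ := by
      refine intervalIntegral.integral_lt_integral_of_continuousOn_of_le_of_exists_lt one_pos
        (by fun_prop) (ContinuousOn.div (by fun_prop) (by fun_prop) fun y hy => (hden y hy).ne')
        (fun y hy => ?_) ⟨0, by simp, ?_⟩
      · have hy := Set.Ioc_subset_Icc_self hy
        have := hden y hy
        rw [hsplit y hy, le_add_iff_nonneg_right]
        positivity
      · have h : n - 1 ≠ 0 := by lia
        have : 0 < ((n : ℝ) * (1 + β))⁻¹ := by positivity
        rw [zero_pow h, zero_mul, zero_div]
        linarith
end

section
/- Fix an integer n ≥ 2, x₀ > 0, σ > 0 and μ ≠ 0. Let s_B(x) = (σ²/(2μ))·(1 - exp(-2μx/σ²)) (so s_B'(x) = exp(-2μx/σ²)), let λ(c) = (1 - n·c + (n-1)·c^{n/(n-1)})/n, and take c ∈ [0,1) with (2μ/σ²)·(1-c)·s_B(x₀)/λ(c) < 1. Let F_c(x) = (c + λ(c)·s_B(x)/s_B(x₀))^{1/(n-1)} for x ∈ [0, x̄(c)] with x̄(c) = -(σ²/(2μ))·log(1 - (2μ/σ²)·(1-c)·s_B(x₀)/λ(c)), and F_c(x)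 = 1 for x ≥ x̄(c). Then ∫₀^{x̄(c)} exp(-2μx/σ²)·(1 - F_c(x)) dx = s_B(x₀); equivalently, the distribution with cdf F_c satisfies the feasibility (Skorokhod-embedding) constraint ∫ s_B(x) dF_c(x) = s_B(x₀). -/
open MeasureTheory

/-- Scale function of Brownian motion with drift `μ` and volatility `σ`:
`s_B(x) = (σ²/(2μ))·(1 - exp(-2μx/σ²))`. -/
noncomputable def sB (μ σ x : ℝ) : ℝ :=
  (σ ^ 2 / (2 * μ)) * (1 - Real.exp (-(2 * μ * x) / σ ^ 2))

/-- Upper bound of the support of the equilibrium distribution for Brownian motion with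
drift: `x̄(c) = -(σ²/(2μ))·log(1 - (2μ/σ²)·(1-c)·s_B(x₀)/λ(c))`. -/
noncomputable def driftXbar (n : ℕ) (x₀ μ σ c : ℝ) : ℝ :=
  -(σ ^ 2 / (2 * μ)) * Real.log (1 - (2 * μ / σ ^ 2) * ((1 - c) * sB μ σ x₀ / lamFee n c))

/-- Equilibrium cdf for Brownian motion with drift:
`F_c(x) = (c + λ(c)·s_B(x)/s_B(x₀))^{1/(n-1)}` on `[0, x̄(c)]`, `1` above, `0` below `0`. -/
noncomputable def driftF (n : ℕ) (x₀ μ σ c x : ℝ) : ℝ :=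
  if x < 0 then 0
  else if x ≤ driftXbar n x₀ μ σ c then
    (c + lamFee n c * sB μ σ x / sB μ σ x₀) ^ ((1 : ℝ) / ((n : ℝ) - 1))
  else 1

theorem lamFee_pos {n : ℕ} (hn : 2 ≤ n) {c : ℝ} (hc : c ∈ Set.Ico (0 : ℝ) 1) :
    0 < lamFee n c := by
  have hn' : (2 : ℝ) ≤ n := by exact_mod_cast hn
  have hm : (0 : ℝ) < n - 1 := by linarith
  have hq : 1 < (n : ℝ) / (n - 1) := by rw [lt_div_iff₀ hm]; linarith
  have h := one_add_mul_self_lt_rpow_one_add (s := c - 1) (by linarith [hc.1])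
    (by linarith [hc.2]) hq
  rw [add_sub_cancel] at h
  have h' := mul_lt_mul_of_pos_left h hm
  have e : ((n : ℝ) - 1) * (1 + n / (n - 1) * (c - 1)) = n * c - 1 := by
    field_simp
    ring
  unfold lamFee
  apply div_pos <;> linarith

theorem sB_pos {μ σ x : ℝ} (hμ : μ ≠ 0) (hσ : 0 < σ) (hx : 0 < x) : 0 < sB μ σ x := by
  unfold sB
  rcases lt_or_gt_of_ne hμ with h | h
  · have h₁ : σ ^ 2 / (2 * μ) < 0 := div_neg_of_pos_of_neg (by positivity) (by linarith)
    have h₂ : 0 < -(2 * μ * x) / σ ^ 2 := div_pos (by nlinarith) (by positivity)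
    exact mul_pos_of_neg_of_neg h₁ (by linarith [Real.one_lt_exp_iff.mpr h₂])
  · have h₂ : -(2 * μ * x) / σ ^ 2 < 0 :=
      div_neg_of_neg_of_pos (neg_lt_zero.mpr (by positivity)) (by positivity)
    exact mul_pos (by positivity) (by linarith [Real.exp_lt_one_iff.mpr h₂])

theorem sB_zero (μ σ : ℝ) : sB μ σ 0 = 0 := by simp [sB]

theorem hasDerivAt_sB {μ σ : ℝ} (hμ : μ ≠ 0) (hσ : σ ≠ 0) (x : ℝ) :
    HasDerivAt (sB μ σ) (Real.exp (-(2 * μ * x) / σ ^ 2)) x := by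
  have h : HasDerivAt (fun y : ℝ => -(2 * μ * y) / σ ^ 2) (-(2 * μ * 1) / σ ^ 2) x :=
    (((hasDerivAt_id x).const_mul (2 * μ)).neg).div_const _
  refine ((h.exp.const_sub 1).const_mul (σ ^ 2 / (2 * μ))).congr_deriv ?_
  field_simp

theorem sB_driftXbar {n : ℕ} {x₀ μ σ c : ℝ} (hμ : μ ≠ 0) (hσ : σ ≠ 0)
    (hcond : (2 * μ / σ ^ 2) * ((1 - c) * sB μ σ x₀ / lamFee n c) < 1) :
    sB μ σ (driftXbar n x₀ μ σ c) = (1 - c) * sB μ σ x₀ / lamFee n c := by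
  unfold driftXbar
  generalize (1 - c) * sB μ σ x₀ / lamFee n c = t at *
  have e : -(2 * μ * (-(σ ^ 2 / (2 * μ)) * Real.log (1 - 2 * μ / σ ^ 2 * t))) / σ ^ 2 =
      Real.log (1 - 2 * μ / σ ^ 2 * t) := by
    field_simp
  rw [sB, e, Real.exp_log (by linarith)]
  field_simp
  ring

theorem driftXbar_pos {n : ℕ} {x₀ μ σ c : ℝ} (hμ : μ ≠ 0) (hσ : 0 < σ)
    (ht : 0 < (1 - c) * sB μ σ x₀ / lamFee n c)
    (hcond : (2 * μ / σ ^ 2) * ((1 - c) * sB μ σ x₀ / lamFee n c) < 1) :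
    0 < driftXbar n x₀ μ σ c := by
  have hmono : StrictMono (sB μ σ) :=
    strictMono_of_hasDerivAt_pos (hasDerivAt_sB hμ hσ.ne') fun _ => Real.exp_pos _
  rw [← hmono.lt_iff_lt, sB_zero, sB_driftXbar hμ hσ.ne' hcond]
  exact ht

/-- The equilibrium distribution for Brownian motion with drift satisfies the feasibility
(Skorokhod-embedding) constraint `∫ s_B dF_c = s_B(x₀)`, expressed via integration by
parts as `∫₀^{x̄(c)} exp(-2μx/σ²)·(1 - F_c(x)) dx = s_B(x₀)`. -/
theorem driftF_feasible (n : ℕ) (hn : 2 ≤ n) (x₀ σ μ : ℝ)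
    (hx₀ : 0 < x₀) (hσ : 0 < σ) (hμ : μ ≠ 0)
    (c : ℝ) (hc : c ∈ Set.Ico (0 : ℝ) 1)
    (hcond : (2 * μ / σ ^ 2) * ((1 - c) * sB μ σ x₀ / lamFee n c) < 1) :
    (∫ x in (0 : ℝ)..(driftXbar n x₀ μ σ c),
        Real.exp (-(2 * μ * x) / σ ^ 2) * (1 - driftF n x₀ μ σ c x)) = sB μ σ x₀ := by
  have hn' : (2 : ℝ) ≤ n := by exact_mod_cast hn
  have hm : (0 : ℝ) < n - 1 := by linarith
  have hl := lamFee_pos hn hc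
  have hS := sB_pos hμ hσ hx₀
  have hX := driftXbar_pos hμ hσ (div_pos (mul_pos (by linarith [hc.2]) hS) hl) hcond
  have hsX := sB_driftXbar hμ hσ.ne' hcond
  set S := sB μ σ x₀
  set l := lamFee n c with hldef
  set X := driftXbar n x₀ μ σ c
  set q : ℝ := n / (n - 1) with hq
  have hq1 : 1 ≤ q := by rw [hq, le_div_iff₀ hm]; linarith
  have hqs : q - 1 = 1 / ((n : ℝ) - 1) := by rw [hq]; field_simp; ring
  have hcongr : Set.EqOn
      (fun x => Real.exp (-(2 * μ * x) / σ ^ 2) * (1 - driftF n x₀ μ σ c x))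
      (fun x => Real.exp (-(2 * μ * x) / σ ^ 2) * (1 - (c + l * sB μ σ x / S) ^ (q - 1)))
      (Set.uIcc 0 X) := by
    intro x hx
    rw [Set.uIcc_of_le hX.le] at hx
    simp only [driftF]
    rw [if_neg (not_lt.mpr hx.1), if_pos hx.2, hqs]
  have hderiv (x : ℝ) : HasDerivAt
      (fun x => sB μ σ x - S / (l * q) * (c + l * sB μ σ x / S) ^ q)
      (Real.exp (-(2 * μ * x) / σ ^ 2) * (1 - (c + l * sB μ σ x / S) ^ (q - 1))) x := by
    have hs := hasDerivAt_sB hμ hσ.ne' x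
    refine (hs.sub (((((hs.const_mul l).div_const S).const_add c).rpow_const
      (Or.inr hq1)).const_mul (S / (l * q)))).congr_deriv ?_
    have : q ≠ 0 := by linarith
    field_simp
  have hcont : Continuous fun x =>
      Real.exp (-(2 * μ * x) / σ ^ 2) * (1 - (c + l * sB μ σ x / S) ^ (q - 1)) := by
    have hs : Continuous (sB μ σ) :=
      continuous_iff_continuousAt.mpr fun x => (hasDerivAt_sB hμ hσ.ne' x).continuousAt
    refine Continuous.mul (by fun_prop) (continuous_const.sub ?_)
    exact Continuous.rpow_const (by fun_prop) fun _ => Or.inr (by linarith)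
  rw [intervalIntegral.integral_congr hcongr,
    intervalIntegral.integral_eq_sub_of_hasDerivAt (fun x _ => hderiv x)
      (hcont.intervalIntegrable _ _), hsX, sB_zero]
  have e : c + l * ((1 - c) * S / l) / S = 1 := by field_simp; ring
  have hlq : l * n = 1 - n * c + (n - 1) * c ^ q := by
    rw [hldef, lamFee, div_mul_cancel₀ _ (by linarith)]
  rw [e, Real.one_rpow, mul_zero, zero_div, add_zero]
  have hqn : S / (l * q) = S / l * ((n - 1) / n) := by rw [hq]; field_simp
  rw [hqn]
  field_simp
  linear_combination (-S) * hlq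
end

section
/- Fix an integer n ≥ 2, x₀ > 0, and κ > 0. Let λ(c) = (1 - n·c + (n-1)·c^{n/(n-1)})/n and take c ∈ [0,1). Let H_c(x) = (c + λ(c)·(x/x₀)^κ)^{1/(n-1)} for x ∈ [0, x̄(c)] with x̄(c) = ((1-c)/λ(c))^{1/κ}·x₀, and H_c(x) = 1 for x ≥ x̄(c). Then ∫₀^{x̄(c)} x^{κ-1}·(1 - H_c(x)) dx = x₀^κ/κ; equivalently, the distribution with cdf H_c satisfies the feasibility (Skorokhod-embedding) constraint ∫ (x^κ/κ) dH_c(x) = x₀^κ/κ for exponential Brownian motion with scale function s(x) = x^κ/κ. -/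
open MeasureTheory

/-- The substitution `y = c + b·x^κ` in integrated form: if `y = 1` at `x = X`, then
`∫₀^X x^{κ-1}·(1 - y^p) dx = (1 - c - (1 - c^{p+1})/(p+1))/(κ·b)`. -/
theorem integral_rpow_mul_one_sub_rpow {κ b c p X : ℝ} (hκ : 0 < κ) (hb : 0 < b)
    (hp : 0 < p) (hX : 0 ≤ X) (hXb : c + b * X ^ κ = 1) :
    ∫ x in (0 : ℝ)..X, x ^ (κ - 1) * (1 - (c + b * x ^ κ) ^ p) =
      (1 - c - (1 - c ^ (p + 1)) / (p + 1)) / (κ * b) := by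
  have hxκ : Continuous fun x : ℝ => x ^ κ := Real.continuous_rpow_const hκ.le
  have hy : Continuous fun x : ℝ => c + b * x ^ κ := by fun_prop
  have hderiv : ∀ x ∈ Set.Ioo 0 X, HasDerivAt
      (fun x : ℝ => x ^ κ / κ - (c + b * x ^ κ) ^ (p + 1) / ((p + 1) * (κ * b)))
      (x ^ (κ - 1) * (1 - (c + b * x ^ κ) ^ p)) x := by
    intro x hx
    have hpow : HasDerivAt (fun x : ℝ => x ^ κ) (κ * x ^ (κ - 1)) x :=
      Real.hasDerivAt_rpow_const (Or.inl hx.1.ne')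
    have hcomp := ((hpow.const_mul b).const_add c).rpow_const (p := p + 1)
      (Or.inr (by linarith))
    refine ((hpow.div_const κ).sub (hcomp.div_const ((p + 1) * (κ * b)))).congr_deriv ?_
    rw [add_sub_cancel_right]
    field_simp
  rw [intervalIntegral.integral_eq_sub_of_hasDerivAt_of_le hX _ hderiv]
  · rw [hXb, Real.one_rpow, Real.zero_rpow hκ.ne', mul_zero, add_zero,
      eq_div_of_mul_eq hb.ne' (by linarith : X ^ κ * b = 1 - c)]
    field_simp
    ring
  · exact (intervalIntegral.intervalIntegrable_rpow' (by linarith)).mul_continuousOn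
      (continuous_const.sub (hy.rpow_const fun _ => Or.inr hp.le)).continuousOn
  · exact ((hxκ.div_const κ).sub ((hy.rpow_const fun _ => Or.inr (by linarith)).div_const
      _)).continuousOn

/-- The equilibrium distribution for exponential Brownian motion (scale function
`s(x) = x^κ/κ`) satisfies the feasibility (Skorokhod-embedding) constraint
`∫ (x^κ/κ) dH_c = x₀^κ/κ`, expressed via integration by parts as
`∫₀^{x̄(c)} x^{κ-1}·(1 - H_c(x)) dx = x₀^κ/κ`. -/
theorem expF_feasible (n : ℕ) (hn : 2 ≤ n) (x₀ κ : ℝ)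
    (hx₀ : 0 < x₀) (hκ : 0 < κ)
    (c : ℝ) (hc : c ∈ Set.Ico (0 : ℝ) 1) :
    (∫ x in (0 : ℝ)..(expXbar n x₀ κ c),
        x ^ (κ - 1) * (1 - expF n x₀ κ c x)) = x₀ ^ κ / κ := by
  have hlam := lamFee_pos hn hc
  have hA : 0 < x₀ ^ κ := Real.rpow_pos_of_pos hx₀ κ
  have hn' : (2 : ℝ) ≤ n := by exact_mod_cast hn
  have hn1 : (0 : ℝ) < n - 1 := by linarith
  have hratio : 0 ≤ (1 - c) / lamFee n c := div_nonneg (by linarith [hc.2]) hlam.le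
  have hX : 0 ≤ expXbar n x₀ κ c := mul_nonneg (Real.rpow_nonneg hratio _) hx₀.le
  have hXb : c + lamFee n c / x₀ ^ κ * expXbar n x₀ κ c ^ κ = 1 := by
    rw [expXbar, Real.mul_rpow (Real.rpow_nonneg hratio _) hx₀.le, ← Real.rpow_mul hratio,
      one_div_mul_cancel hκ.ne', Real.rpow_one]
    field_simp
    ring
  have hcongr : Set.EqOn (fun x => x ^ (κ - 1) * (1 - expF n x₀ κ c x))
      (fun x => x ^ (κ - 1) *
        (1 - (c + lamFee n c / x₀ ^ κ * x ^ κ) ^ ((1 : ℝ) / ((n : ℝ) - 1))))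
      (Set.uIcc 0 (expXbar n x₀ κ c)) := by
    intro x hx
    rw [Set.uIcc_of_le hX] at hx
    simp only [expF, if_neg hx.1.not_gt, if_pos hx.2, Real.div_rpow hx.1 hx₀.le,
      mul_div_assoc', div_mul_eq_mul_div]
  rw [intervalIntegral.integral_congr hcongr, integral_rpow_mul_one_sub_rpow hκ
    (div_pos hlam hA) (one_div_pos.mpr hn1) hX hXb]
  have hp : (1 : ℝ) / (n - 1) + 1 = n / (n - 1) := by
    field_simp
    ring
  have hval : 1 - c - (1 - c ^ ((n : ℝ) / (n - 1))) / (n / (n - 1)) = lamFee n c := by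
    unfold lamFee
    field_simp
    ring
  rw [hp, hval]
  field_simp
end
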